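/- Let S ∈ M₄(ℂ) be the swap matrix and cH = diag(I₂, H) the controlled-Hadamard matrix. Then the matrix S·cH has infinite multiplicative order: for every positive integer n, (S·cH)^n ≠ I₄. -/

import Mathlib

open Matrix

/-- The swap matrix on `ℂ² ⊗ ℂ²`: the permutation matrix with `S(e_a ⊗ e_b) = e_b ⊗ e_a`. -/
def swapMat : Matrix (Fin 2 × Fin 2) (Fin 2 × Fin 2) ℂ :=
  fun p q => if p.1 = q.2 ∧ p.2 = q.1 then 1 else 0

/-- The Hadamard matrix. -/
noncomputable def hadamard : Matrix (Fin 2) (Fin 2) ℂ :=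
  ((Real.sqrt 2 : ℂ))⁻¹ • !![1, 1; 1, -1]

/-- The controlled-Hadamard matrix `diag(I₂, H)` (the first factor is the control). -/
noncomputable def cH : Matrix (Fin 2 × Fin 2) (Fin 2 × Fin 2) ℂ :=
  fun p q => if p.1 = q.1 then
    (if p.1 = 1 then hadamard p.2 q.2 else (1 : Matrix (Fin 2) (Fin 2) ℂ) p.2 q.2) else 0

/-- The matrix `S·cH` has infinite multiplicative order: for every
positive integer `n`, `(S·cH)^n ≠ I₄`. -/
theorem swap_mul_cH_infinite_order :
    ∀ n : ℕ, 0 < n → (swapMat * cH) ^ n ≠ 1 := by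
  intro n hn h
  obtain ⟨r, hr⟩ : ∃ r : ℂ, r = (Real.sqrt 2 : ℂ) := ⟨_, rfl⟩
  have hr2 : r * r = 2 := by
    rw [hr, ← Complex.ofReal_mul, Real.mul_self_sqrt (by norm_num)]; norm_num
  have hr0 : r ≠ 0 := by rintro rfl; norm_num at hr2
  obtain ⟨s, hs⟩ : ∃ s : ℂ, s = r⁻¹ := ⟨_, rfl⟩
  have hrs : r * s = 1 := by rw [hs]; exact mul_inv_cancel₀ hr0
  have hs2 : 2 * (s * s) = 1 := by linear_combination (-s*s) * hr2 + (r * s + 1) * hrs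
  -- an eigenvalue
  obtain ⟨d, hd⟩ := IsAlgClosed.exists_pow_nat_eq (((1 + s) ^ 2 - 4 : ℂ)) (n := 2) (by norm_num)
  obtain ⟨x, hx⟩ : ∃ x : ℂ, x * x + (1 + s) * x + 1 = 0 :=
    ⟨(-(1 + s) + d) / 2, by linear_combination hd / 4⟩
  have hx0 : x ≠ 0 := by rintro rfl; norm_num at hx
  let v : Fin 2 × Fin 2 → ℂ := fun p => !![0, x; 1, x * x * r - 1] p.1 p.2
  have hv : (swapMat * cH) *ᵥ v = x • v := by
    rw [← Matrix.mulVec_mulVec]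
    funext ⟨i, j⟩
    fin_cases i <;> fin_cases j <;>
      simp [Matrix.mulVec, dotProduct, Fintype.sum_prod_type, swapMat, cH, _root_.hadamard, v, ← hr, ← hs]
    · linear_combination x * x * hrs
    · linear_combination (-r * (x - 1)) * hx + (r - x) * hrs - s * hr2
  have hpow : ∀ k : ℕ, ((swapMat * cH) ^ k) *ᵥ v = x ^ k • v := by
    intro k
    induction k with
    | zero => simp
    | succ k ih =>
      rw [pow_succ, ← Matrix.mulVec_mulVec, hv, Matrix.mulVec_smul, ih, smul_smul, pow_succ, mul_comm]
  have hxn : x ^ n = 1 := by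
    have := congrFun (hpow n) (1, 0)
    rw [h] at this
    simpa [v] using this.symm
  have hint : IsIntegral ℤ x := IsIntegral.of_pow hn (by rw [hxn]; exact isIntegral_one)
  have hint' : IsIntegral ℤ x⁻¹ :=
    IsIntegral.of_pow hn (by rw [inv_pow, hxn, inv_one]; exact isIntegral_one)
  have hsint : IsIntegral ℤ s := by
    have : s = -(x + x⁻¹) - 1 := by field_simp; linear_combination hx
    rw [this]
    exact ((hint.add hint').neg).sub isIntegral_one
  have hhalf : IsIntegral ℤ (algebraMap ℚ ℂ (1 / 2)) := by
    have : algebraMap ℚ ℂ (1 / 2) = s * s := by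
      simp; linear_combination -hs2 / 2
    rw [this]; exact hsint.mul hsint
  rw [isIntegral_algebraMap_iff (algebraMap ℚ ℂ).injective] at hhalf
  obtain ⟨y, hy⟩ := IsIntegrallyClosed.isIntegral_iff.mp hhalf
  have h2 : (2 * y : ℚ) = 1 := by simp at hy; rw [hy]; norm_num
  have h3 : 2 * y = 1 := by exact_mod_cast h2
  omega
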